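/- arXiv:cs/0607094 — 3 statements merged into one kernel-verified Lean document; each statement's English description precedes it below -/
import Mathlib

section
/- Let 𝓕 be a family of finite subsets of a set U satisfying axioms L1 and L2. Then the union of any two members of 𝓕 also belongs to 𝓕. -/
/-- Axiom L1 of a learning space. -/
def AxiomL1 {U : Type*} [DecidableEq U] (F : Set (Finset U)) : Prop :=
  ∀ S ∈ F, S.Nonempty → ∃ x ∈ S, S.erase x ∈ F

/-- Axiom L2 of a learning space. -/
def AxiomL2 {U : Type*} [DecidableEq U] (F : Set (Finset U)) : Prop :=
  ∀ (S : Finset U) (x y : U), S ∈ F → insert x S ∈ F → insert y S ∈ F →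
    insert x (insert y S) ∈ F

/-- A family of finite sets satisfying axioms L1 and L2 is closed under unions. -/
theorem union_mem {U : Type*} [DecidableEq U] (F : Set (Finset U))
    (hL1 : AxiomL1 F) (hL2 : AxiomL2 F) (S T : Finset U)
    (hS : S ∈ F) (hT : T ∈ F) : S ∪ T ∈ F := by
  induction S using Finset.strongInduction generalizing T with
  | H S ihS =>
    induction T using Finset.strongInduction with
    | H T ihT =>
      rcases S.eq_empty_or_nonempty with rfl | hSne
      · simpa using hT
      rcases T.eq_empty_or_nonempty with rfl | hTne
      · simpa using hS
      obtain ⟨x, hxS, hx⟩ := hL1 S hS hSne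
      obtain ⟨y, hyT, hy⟩ := hL1 T hT hTne
      have hbase := ihS _ (Finset.erase_ssubset hxS) _ hx hy
      have hleft : insert x (S.erase x ∪ T.erase y) ∈ F := by
        rw [← Finset.insert_union, Finset.insert_erase hxS]
        exact ihT _ (Finset.erase_ssubset hyT) hy
      have hright : insert y (S.erase x ∪ T.erase y) ∈ F := by
        rw [← Finset.union_insert, Finset.insert_erase hyT]
        exact ihS _ (Finset.erase_ssubset hxS) _ hx hT
      have h := hL2 _ x y hbase hleft hright
      rwa [← Finset.union_insert, Finset.insert_erase hyT, ← Finset.insert_union,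
        Finset.insert_erase hxS] at h
end

section
/- Let 𝓕 be a family of finite subsets of a set U satisfying axioms L1 and L2. Then 𝓕 is well-graded: for any S, T ∈ 𝓕, writing d = |S Δ T| for the size of their symmetric difference, there exists a sequence of sets W₀ = S, W₁, …, W_d = T, all belonging to 𝓕, such that each consecutive pair Wᵢ, Wᵢ₊₁ differs by exactly one element (|Wᵢ Δ Wᵢ₊₁| = 1). -/
theorem card_sdiff_insert_union {U : Type*} [DecidableEq U] {S T : Finset U} {x : U} {d : ℕ}
    (hxT : x ∈ T) (hxS : x ∉ S) (hd : ((S \ T) ∪ (T \ S)).card = d + 1) :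
    ((insert x S \ T) ∪ (T \ insert x S)).card = d := by
  have h : (insert x S \ T) ∪ (T \ insert x S) = ((S \ T) ∪ (T \ S)).erase x := by
    grind
  rw [h, Finset.card_erase_of_mem (by grind), hd, Nat.add_sub_cancel]

theorem card_sdiff_insert_self_union {U : Type*} [DecidableEq U] {S : Finset U} {x : U}
    (hx : x ∉ S) : ((S \ insert x S) ∪ (insert x S \ S)).card = 1 := by
  have h : (S \ insert x S) ∪ (insert x S \ S) = {x} := by grind
  rw [h, Finset.card_singleton]

/-- A member not contained in `S` contributes a point extending `S`, provided that one-point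
extensions of members contained in `S` extend `S` as well. -/
theorem exists_insert_mem_of_not_subset {U : Type*} [DecidableEq U] {F : Set (Finset U)}
    (hL1 : AxiomL1 F) {S : Finset U}
    (hS : ∀ A ∈ F, A ⊆ S → ∀ x, insert x A ∈ F → insert x S ∈ F)
    (T : Finset U) (hT : T ∈ F) (hTS : ¬ T ⊆ S) :
    ∃ x ∈ T, x ∉ S ∧ insert x S ∈ F := by
  induction T using Finset.strongInduction with
  | H T ih =>
    have hne : T.Nonempty := by
      rw [Finset.nonempty_iff_ne_empty]
      rintro rfl
      exact hTS (Finset.empty_subset S)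
    obtain ⟨z, hz, hzF⟩ := hL1 T hT hne
    by_cases hsub : T.erase z ⊆ S
    · refine ⟨z, hz, fun hzS => hTS ?_, hS _ hzF hsub z (by rwa [Finset.insert_erase hz])⟩
      rw [← Finset.insert_erase hz]
      exact Finset.insert_subset hzS hsub
    · obtain ⟨x, hx, hxS, hxF⟩ := ih _ (Finset.erase_ssubset hz) hzF hsub
      exact ⟨x, Finset.mem_of_mem_erase hx, hxS, hxF⟩

/-- A one-point extension of a member `A ⊆ S` extends `S` by the same point. -/
theorem insert_mem_of_subset {U : Type*} [DecidableEq U] {F : Set (Finset U)}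
    (hL1 : AxiomL1 F) (hL2 : AxiomL2 F) (S : Finset U) (hS : S ∈ F) :
    ∀ A ∈ F, A ⊆ S → ∀ x, insert x A ∈ F → insert x S ∈ F := by
  induction S using Finset.strongInduction with
  | H S ih =>
    intro A hA hAS x hx
    induction hn : (S \ A).card using Nat.strong_induction_on generalizing A with
    | h n ihn =>
      by_cases hSA : S ⊆ A
      · rwa [hSA.antisymm hAS]
      · obtain ⟨y, hyS, hyA, hyF⟩ :=
          exists_insert_mem_of_not_subset hL1 (ih A ⟨hAS, hSA⟩ hA) S hS hSA
        refine ihn _ ?_ _ hyF (Finset.insert_subset hyS hAS) (hL2 A x y hA hx hyF) rfl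
        rw [← hn]
        apply Finset.card_lt_card
        rw [Finset.ssubset_iff_of_subset (by grind)]
        exact ⟨y, by grind, by grind⟩

theorem exists_insert_mem {U : Type*} [DecidableEq U] {F : Set (Finset U)}
    (hL1 : AxiomL1 F) (hL2 : AxiomL2 F) {S T : Finset U} (hS : S ∈ F) (hT : T ∈ F)
    (hTS : ¬ T ⊆ S) : ∃ x ∈ T, x ∉ S ∧ insert x S ∈ F :=
  exists_insert_mem_of_not_subset hL1 (insert_mem_of_subset hL1 hL2 S hS) T hT hTS

/-- A family of finite sets satisfying axioms L1 and L2 is well-graded: any two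
of its members `S`, `T` with `d = |S Δ T|` are connected by a sequence
`S = W₀, W₁, …, W_d = T` in the family whose consecutive members differ in a
single element. -/
theorem wellgraded {U : Type*} [DecidableEq U] (F : Set (Finset U))
    (hL1 : AxiomL1 F) (hL2 : AxiomL2 F) (S T : Finset U)
    (hS : S ∈ F) (hT : T ∈ F) (d : ℕ) (hd : ((S \ T) ∪ (T \ S)).card = d) :
    ∃ W : ℕ → Finset U, W 0 = S ∧ W d = T ∧ (∀ i ≤ d, W i ∈ F) ∧
      ∀ i < d, ((W i \ W (i + 1)) ∪ (W (i + 1) \ W i)).card = 1 := by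
  induction d generalizing S T with
  | zero =>
    have hST : S = T := by
      have h := Finset.card_eq_zero.mp hd
      rw [Finset.union_eq_empty, Finset.sdiff_eq_empty_iff_subset,
        Finset.sdiff_eq_empty_iff_subset] at h
      exact h.1.antisymm h.2
    exact ⟨fun _ => S, rfl, hST, fun _ _ => hS, by simp⟩
  | succ d ih =>
    by_cases hTS : T ⊆ S
    · have hnST : ¬ S ⊆ T := by
        intro h
        simp [h.antisymm hTS] at hd
      obtain ⟨x, hxS, hxT, hxF⟩ := exists_insert_mem hL1 hL2 hT hS hnST
      have hcard : ((S \ insert x T) ∪ (insert x T \ S)).card = d := by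
        rw [Finset.union_comm] at hd ⊢
        exact card_sdiff_insert_union hxS hxT hd
      obtain ⟨W, hW0, hWd, hWF, hW⟩ := ih S (insert x T) hS hxF hcard
      refine ⟨fun i => if i ≤ d then W i else T, by simpa using hW0, by simp, ?_, ?_⟩
      · intro i _
        by_cases h : i ≤ d
        · simpa [h] using hWF i h
        · simpa [h] using hT
      · intro i hi
        rcases (Nat.lt_succ_iff.mp hi).lt_or_eq with h | rfl
        · simpa [h.le, Nat.succ_le_of_lt h] using hW i h
        · simp only [le_refl, if_true, hWd, Nat.not_succ_le_self, if_false]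
          rw [Finset.union_comm]
          exact card_sdiff_insert_self_union hxT
    · obtain ⟨x, hxT, hxS, hxF⟩ := exists_insert_mem hL1 hL2 hS hT hTS
      obtain ⟨W, hW0, hWd, hWF, hW⟩ := ih (insert x S) T hxF hT
        (card_sdiff_insert_union hxT hxS hd)
      refine ⟨fun i => Nat.casesOn i S W, rfl, hWd, ?_, ?_⟩
      · rintro (_ | i) hi
        · exact hS
        · exact hWF i (Nat.le_of_succ_le_succ hi)
      · rintro (_ | i) hi
        · simp only [hW0]
          exact card_sdiff_insert_self_union hxS
        · exact hW i (Nat.lt_of_succ_lt_succ hi)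
end

section
/- Let n ∈ ℕ and let a, b : Fin n → ℝ be injective functions; for i ∈ Fin n let Q i = {p ∈ ℝ² | p₁ ≤ a i ∧ p₂ ≤ b i}, and for p ∈ ℝ² let S(p) = {i ∈ Fin n | p ∉ Q i}. Suppose S = S(q) for some q ∈ ℝ² and S ≠ Fin n, and let m = (min_{i∉S} a i, min_{i∉S} b i). Then S(m) = S, and every point p with S(p) = S satisfies p₁ ≤ m₁ and p₂ ≤ m₂; that is, every region of the arrangement other than the upper-right region has a unique maximal point. -/
/-- The set of quadrants `Q i = {p | p₁ ≤ a i ∧ p₂ ≤ b i}` not containing a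
point `p` of the plane. -/
noncomputable def regionSet {n : ℕ} (a b : Fin n → ℝ) (p : ℝ × ℝ) : Finset (Fin n) :=
  Finset.univ.filter fun i => ¬(p.1 ≤ a i ∧ p.2 ≤ b i)

theorem mem_regionSet {n : ℕ} {a b : Fin n → ℝ} {p : ℝ × ℝ} {i : Fin n} :
    i ∈ regionSet a b p ↔ ¬(p.1 ≤ a i ∧ p.2 ≤ b i) := by
  simp [regionSet]

/-- Every region of an arrangement of quadrants other than the upper-right
region (the one whose set is all of `Fin n`) has a unique maximal point,
namely `m = (min_{i ∉ S} a i, min_{i ∉ S} b i)`: the point `m` lies in the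
region, and every point of the region is dominated by `m`. -/
theorem region_maximal_point (n : ℕ) (a b : Fin n → ℝ)
    (ha : Function.Injective a) (hb : Function.Injective b)
    (q : ℝ × ℝ) (S : Finset (Fin n)) (hS : regionSet a b q = S)
    (hStop : S ≠ Finset.univ)
    (m : ℝ × ℝ)
    (hm : m = (sInf (a '' {i | i ∉ S}), sInf (b '' {i | i ∉ S}))) :
    regionSet a b m = S ∧
      ∀ p : ℝ × ℝ, regionSet a b p = S → p.1 ≤ m.1 ∧ p.2 ≤ m.2 := by
  have hne : {i | i ∉ S}.Nonempty := by
    by_contra h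
    exact hStop (Finset.eq_univ_iff_forall.2 fun i => by_contra fun hi => h ⟨i, hi⟩)
  have hdom : ∀ p : ℝ × ℝ, regionSet a b p = S → p.1 ≤ m.1 ∧ p.2 ≤ m.2 := by
    intro p hp
    have hle : ∀ i, i ∉ S → p.1 ≤ a i ∧ p.2 ≤ b i := fun i hi => by
      rwa [← hp, mem_regionSet, not_not] at hi
    subst hm
    constructor
    · exact le_csInf (hne.image a) (Set.forall_mem_image.2 fun i hi => (hle i hi).1)
    · exact le_csInf (hne.image b) (Set.forall_mem_image.2 fun i hi => (hle i hi).2)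
  refine ⟨Finset.ext fun i => ?_, hdom⟩
  rw [mem_regionSet]
  constructor
  · intro h
    by_contra hi
    subst hm
    exact h ⟨csInf_le (Set.toFinite _).bddBelow (Set.mem_image_of_mem a hi),
      csInf_le (Set.toFinite _).bddBelow (Set.mem_image_of_mem b hi)⟩
  · intro hi h
    rw [← hS, mem_regionSet] at hi
    obtain ⟨h₁, h₂⟩ := hdom q hS
    exact hi ⟨h₁.trans h.1, h₂.trans h.2⟩
end
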